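/- arXiv:2112.14521 — 11 statements merged into one kernel-verified Lean document; each statement's English description precedes it below -/
import Mathlib

section
/- Let n, K be positive integers, let μ : {1,…,n} → ℕ and m : {1,…,K} → ℕ be families of positive integer weights, and let Φ : ℂⁿ × ℝᴷ → ℝᴷ be real-differentiable and satisfy Φ_β(t^{μ₁}z₁,…,t^{μₙ}zₙ, t^{m₁}u₁,…,t^{m_K}u_K) = t^{m_β}·Φ_β(z,u) for every real t, every (z,u) and every β. Define ρ_β : ℂⁿ × ℂᴷ → ℝ by ρ_β(z,w) = Im w_β − Φ_β(z, Re w). Then at every point p = (z,w) of Q = {ρ_β = 0 for all β}, the grading direction vector X₀(p) = ((μ_j z_j)_{j=1}^n, (m_β w_β)_{β=1}^K) ∈ ℂⁿ × ℂᴷ lies in the kernel of the real Fréchet derivative of every ρ_β at p; that is, the grading vector field X₀ = 2 Re(Σ_j μ_j z_j ∂/∂z_j + Σ_β m_β w_β ∂/∂w_β) is tangent to Q at every point of Q. -/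
open Complex

/-- A function that is constantly zero along a differentiable curve has a derivative vanishing on
the velocity vector of the curve. -/
theorem fderiv_apply_eq_zero_of_comp_eq_zero {E F : Type*} [NormedAddCommGroup E]
    [NormedSpace ℝ E] [NormedAddCommGroup F] [NormedSpace ℝ F] {f : E → F} {c : ℝ → E} {v x : E}
    {t₀ : ℝ} (hf : DifferentiableAt ℝ f x) (hc : HasDerivAt c v t₀) (hx : c t₀ = x)
    (h : ∀ t, f (c t) = 0) : fderiv ℝ f x v = 0 := by
  subst hx
  have h₁ : HasDerivAt (f ∘ c) (fderiv ℝ f (c t₀) v) t₀ :=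
    hf.hasFDerivAt.comp_hasDerivAt t₀ hc
  have h₂ : f ∘ c = fun _ => 0 := funext h
  rw [h₂] at h₁
  exact h₁.unique (hasDerivAt_const t₀ 0)

/-- The velocity at time `1` of the weighted dilation `t ↦ (t ^ μ j • z j)`. -/
theorem hasDerivAt_pow_smul_one {ι : Type*} [Fintype ι] (μ : ι → ℕ) (z : ι → ℂ) :
    HasDerivAt (fun (t : ℝ) j => (t ^ μ j : ℝ) • z j) (fun j => (μ j : ℂ) * z j) 1 := by
  rw [hasDerivAt_pi]
  intro j
  simpa using (hasDerivAt_pow (μ j) (1 : ℝ)).smul_const (z j)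

/-- The grading vector field `X₀ = 2 Re (Σ μ_j z_j ∂/∂z_j + Σ m_β w_β ∂/∂w_β)`
is tangent to the weighted model surface `Q` at every point of `Q`:
its value at each point of `Q` lies in the kernel of the real Fréchet
derivative of every defining function `ρ_β`. -/
theorem grading_vector_field_tangent_to_model_surface
    (n K : ℕ) (hn : 0 < n) (hK : 0 < K)
    (μ : Fin n → ℕ) (m : Fin K → ℕ)
    (hμ : ∀ j, 0 < μ j) (hm : ∀ β, 0 < m β)
    (Φ : ((Fin n → ℂ) × (Fin K → ℝ)) → (Fin K → ℝ))
    (hdiff : Differentiable ℝ Φ)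
    (hΦ : ∀ (t : ℝ) (z : Fin n → ℂ) (u : Fin K → ℝ) (β : Fin K),
      Φ (fun j => (t ^ μ j : ℝ) • z j, fun γ => t ^ m γ * u γ) β
        = t ^ m β * Φ (z, u) β)
    (ρ : Fin K → ((Fin n → ℂ) × (Fin K → ℂ)) → ℝ)
    (hρ : ∀ β p, ρ β p = (p.2 β).im - Φ (p.1, fun γ => (p.2 γ).re) β)
    (Q : Set ((Fin n → ℂ) × (Fin K → ℂ)))
    (hQ : Q = {p | ∀ β, ρ β p = 0})
    (p : (Fin n → ℂ) × (Fin K → ℂ)) (hp : p ∈ Q) (β : Fin K) :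
    fderiv ℝ (ρ β) p
      ((fun j => (μ j : ℂ) * p.1 j), (fun γ => (m γ : ℂ) * p.2 γ)) = 0 := by
  have hρdiff : DifferentiableAt ℝ (ρ β) p := by
    have hre : Differentiable ℝ fun q : (Fin n → ℂ) × (Fin K → ℂ) =>
        (q.1, fun γ => (q.2 γ).re) := by
      refine differentiable_fst.prodMk (differentiable_pi.2 fun γ => ?_)
      exact reCLM.differentiable.comp (differentiable_pi.1 differentiable_snd γ)
    have him : Differentiable ℝ fun q : (Fin n → ℂ) × (Fin K → ℂ) => (q.2 β).im :=
      imCLM.differentiable.comp (differentiable_pi.1 differentiable_snd β)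
    rw [funext (hρ β)]
    exact (him.sub (differentiable_pi.1 (hdiff.comp hre) β)) p
  refine fderiv_apply_eq_zero_of_comp_eq_zero hρdiff
    ((hasDerivAt_pow_smul_one μ p.1).prodMk (hasDerivAt_pow_smul_one m p.2))
    (by simp) fun t => ?_
  have hpβ : ρ β p = 0 := by
    rw [hQ] at hp
    exact hp β
  rw [hρ] at hpβ ⊢
  simp only [real_smul, re_ofReal_mul, im_ofReal_mul] at hΦ ⊢
  rw [hΦ, ← mul_sub, hpβ, mul_zero]
end

section
/- Let n ≥ 1 and let M ⊂ ℂ^{n+2} be the real hypersurface M = {(z₁,…,zₙ,ζ,w) : Im w = 2 Re(Σ_{j=1}^n z_j·(conj ζ)^j)}. Then for every a = (a₁,…,aₙ) ∈ ℂⁿ the polynomial map z_j ↦ z_j + a_j (j = 1,…,n), ζ ↦ ζ, w ↦ w + 2i·Σ_{j=1}^n (conj a_j)·ζ^j maps M bijectively onto itself, and it maps the origin to the point (a, 0, 0) of M. -/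
open Complex

theorem re_sum_conj_mul_pow_succ {n : ℕ} (a : Fin n → ℂ) (ζ : ℂ) :
    (∑ j : Fin n, (starRingEnd ℂ) (a j) * ζ ^ ((j : ℕ) + 1)).re =
      (∑ j : Fin n, a j * ((starRingEnd ℂ) ζ) ^ ((j : ℕ) + 1)).re := by
  rw [← conj_re]
  simp only [map_sum, map_mul, map_pow, conj_conj]

/-- For every `a ∈ ℂⁿ`, the polynomial map `z ↦ z + a`, `ζ ↦ ζ`,
`w ↦ w + 2i Σ_j ā_j ζ^j` maps the hypersurface
`Im w = 2 Re (Σ_{j=1}^n z_j ζ̄^j)` bijectively onto itself and sends the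
origin to the point `(a, 0, 0)` of `M`. -/
theorem translation_bijOn_AL_hypersurface
    (n : ℕ) (hn : 1 ≤ n)
    (M : Set ((Fin n → ℂ) × ℂ × ℂ))
    (hM : M = {p | p.2.2.im =
      2 * (∑ j : Fin n, p.1 j * ((starRingEnd ℂ) p.2.1) ^ ((j : ℕ) + 1)).re})
    (a : Fin n → ℂ) :
    Set.BijOn (fun p : (Fin n → ℂ) × ℂ × ℂ =>
      ((fun j : Fin n => p.1 j + a j), p.2.1,
        p.2.2 + 2 * I * ∑ j : Fin n, (starRingEnd ℂ) (a j) * p.2.1 ^ ((j : ℕ) + 1)))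
      M M ∧
    (fun p : (Fin n → ℂ) × ℂ × ℂ =>
      ((fun j : Fin n => p.1 j + a j), p.2.1,
        p.2.2 + 2 * I * ∑ j : Fin n, (starRingEnd ℂ) (a j) * p.2.1 ^ ((j : ℕ) + 1)))
      (0, 0, 0) = (a, 0, 0) ∧
    ((a, 0, 0) : (Fin n → ℂ) × ℂ × ℂ) ∈ M := by
  have im_two_I_mul (S : ℂ) : (2 * I * S).im = 2 * S.re := by simp
  subst hM
  refine ⟨⟨?_, ?_, ?_⟩, ?_, ?_⟩
  · rintro ⟨z, ζ, w⟩ hp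
    simp only [Set.mem_ofPred_eq] at hp ⊢
    rw [add_im, im_two_I_mul, re_sum_conj_mul_pow_succ, hp]
    simp only [add_mul, Finset.sum_add_distrib, add_re, mul_add]
  · rintro ⟨z, ζ, w⟩ - ⟨z', ζ', w'⟩ - h
    simp only [Prod.mk.injEq] at h
    obtain ⟨hz, rfl, hw⟩ := h
    obtain rfl : z = z' := funext fun j => add_right_cancel (congrFun hz j)
    rw [add_right_cancel hw]
  · rintro ⟨z, ζ, w⟩ hp
    refine ⟨(fun j => z j - a j, ζ,
      w - 2 * I * ∑ j : Fin n, (starRingEnd ℂ) (a j) * ζ ^ ((j : ℕ) + 1)), ?_, ?_⟩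
    · simp only [Set.mem_ofPred_eq] at hp ⊢
      rw [sub_im, im_two_I_mul, re_sum_conj_mul_pow_succ, hp]
      simp only [sub_mul, Finset.sum_sub_distrib, sub_re, mul_sub]
    · simp
  · simp
  · simp
end

section
/- Let Q ⊂ ℂ⁴ be the real hypersurface Q = {(z₁,z₂,ζ,w) ∈ ℂ⁴ : Im w = 2 Re(z₁·conj ζ + z₂·(conj ζ)²)} and let ρ(z₁,z₂,ζ,w) = Im w − 2 Re(z₁·conj ζ + z₂·(conj ζ)²). Then for all b, c ∈ ℂ and e ∈ ℝ, the map X : ℂ⁴ → ℂ⁴ given by X(z₁,z₂,ζ,w) = (−2·(conj c)·z₂ + i e ζ, b, c, 2i·(conj c)·z₁ + 2i·(conj b)·ζ²) satisfies: for every point p ∈ Q the real Fréchet derivative of ρ at p evaluated at X(p) equals zero. In other words, the holomorphic vector field 2 Re((−2 c̄ z₂ + i e ζ)∂/∂z₁ + b ∂/∂z₂ + c ∂/∂ζ + (2i c̄ z₁ + 2i b̄ ζ²)∂/∂w) is tangent to Q at every point of Q. -/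
open Complex

/-- The real derivative of `Im w - 2 Re (z₁ ζ̄ + z₂ ζ̄²)` at `p` in the direction `v`. -/
theorem fderiv_im_sub_two_mul_re_apply (p v : ℂ × ℂ × ℂ × ℂ) :
    fderiv ℝ (fun q : ℂ × ℂ × ℂ × ℂ => q.2.2.2.im -
      2 * (q.1 * (starRingEnd ℂ) q.2.2.1 + q.2.1 * ((starRingEnd ℂ) q.2.2.1) ^ 2).re) p v =
    v.2.2.2.im - 2 * (v.1 * (starRingEnd ℂ) p.2.2.1 + p.1 * (starRingEnd ℂ) v.2.2.1 +
      v.2.1 * ((starRingEnd ℂ) p.2.2.1) ^ 2 +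
      2 * p.2.1 * (starRingEnd ℂ) p.2.2.1 * (starRingEnd ℂ) v.2.2.1).re := by
  have hid := hasFDerivAt_id (𝕜 := ℝ) p
  have hζ := conjCLE.toContinuousLinearMap.hasFDerivAt.comp p hid.snd.snd.fst
  have him := imCLM.hasFDerivAt.comp p hid.snd.snd.snd
  have hre := reCLM.hasFDerivAt.comp p ((hid.fst.mul hζ).add (hid.snd.fst.mul (hζ.pow 2)))
  have h := (him.sub (hre.const_mul 2)).fderiv
  refine (DFunLike.congr_fun h v).trans ?_
  simp
  ring

/-- The weight `-1` graded vector fields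
`(−2 c̄ z₂ + i e ζ, b, c, 2i c̄ z₁ + 2i b̄ ζ²)` are tangent to the weighted
model hypersurface `Q = {Im w = 2 Re (z₁ ζ̄ + z₂ ζ̄²)}` at every point of `Q`. -/
theorem g_minus_one_tangent_to_cubic_model
    (Q : Set (ℂ × ℂ × ℂ × ℂ))
    (hQ : Q = {p : ℂ × ℂ × ℂ × ℂ | p.2.2.2.im =
      2 * (p.1 * (starRingEnd ℂ) p.2.2.1 + p.2.1 * ((starRingEnd ℂ) p.2.2.1) ^ 2).re})
    (ρ : ℂ × ℂ × ℂ × ℂ → ℝ)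
    (hρ : ∀ p, ρ p = p.2.2.2.im -
      2 * (p.1 * (starRingEnd ℂ) p.2.2.1 + p.2.1 * ((starRingEnd ℂ) p.2.2.1) ^ 2).re)
    (b c : ℂ) (e : ℝ)
    (X : ℂ × ℂ × ℂ × ℂ → ℂ × ℂ × ℂ × ℂ)
    (hX : ∀ p, X p = (-2 * (starRingEnd ℂ) c * p.2.1 + I * e * p.2.2.1, b, c,
      2 * I * (starRingEnd ℂ) c * p.1 + 2 * I * (starRingEnd ℂ) b * p.2.2.1 ^ 2)) :
    ∀ p ∈ Q, fderiv ℝ ρ p (X p) = 0 := by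
  intro p _
  rw [funext hρ, fderiv_im_sub_two_mul_re_apply, hX]
  simp [pow_two]
  ring
end

section
/- Let Q ⊂ ℂ⁴ be the real hypersurface Q = {(z₁,z₂,ζ,w) ∈ ℂ⁴ : Im w = 2 Re(z₁·conj ζ + z₂·(conj ζ)²)} and let ρ(z₁,z₂,ζ,w) = Im w − 2 Re(z₁·conj ζ + z₂·(conj ζ)²). Then for all β₁ ∈ ℂ and β₂ ∈ ℝ, the map X : ℂ⁴ → ℂ⁴ given by X(z₁,z₂,ζ,w) = (2i·(conj β₁)·z₁ ζ + β₁ w, 2i·(conj β₁)·z₂ ζ − i β₁ z₁ + i β₂ ζ², i·(conj β₁)·ζ², 2i·(conj β₁)·ζ w) satisfies: for every point p ∈ Q the real Fréchet derivative of ρ at p evaluated at X(p) equals zero. In other words, this weight +1 polynomial vector field is tangent to Q at every point of Q. -/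
open Complex

/-- The real derivative of the defining function
`(z₁, z₂, ζ, w) ↦ Im w − 2 Re (z₁ ζ̄ + z₂ ζ̄²)` in the direction `v`. -/
theorem fderiv_cubic_model_apply (p v : ℂ × ℂ × ℂ × ℂ) :
    fderiv ℝ (fun p : ℂ × ℂ × ℂ × ℂ => p.2.2.2.im -
      2 * (p.1 * (starRingEnd ℂ) p.2.2.1 + p.2.1 * ((starRingEnd ℂ) p.2.2.1) ^ 2).re) p v =
    v.2.2.2.im - 2 * (v.1 * (starRingEnd ℂ) p.2.2.1 + p.1 * (starRingEnd ℂ) v.2.2.1 +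
      v.2.1 * ((starRingEnd ℂ) p.2.2.1) ^ 2 +
      2 * p.2.1 * (starRingEnd ℂ) p.2.2.1 * (starRingEnd ℂ) v.2.2.1).re := by
  have hz₁ : HasFDerivAt (𝕜 := ℝ) (fun q : ℂ × ℂ × ℂ × ℂ => q.1) _ p := hasFDerivAt_fst
  have h₂ : HasFDerivAt (𝕜 := ℝ) (fun q : ℂ × ℂ × ℂ × ℂ => q.2) _ p := hasFDerivAt_snd
  have hζ : HasFDerivAt (𝕜 := ℝ) (fun q : ℂ × ℂ × ℂ × ℂ => (starRingEnd ℂ) q.2.2.1) _ p :=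
    conjCLE.toContinuousLinearMap.hasFDerivAt.comp p h₂.snd.fst
  have hw : HasFDerivAt (𝕜 := ℝ) (fun q : ℂ × ℂ × ℂ × ℂ => q.2.2.2.im) _ p :=
    imCLM.hasFDerivAt.comp p h₂.snd.snd
  have hP := reCLM.hasFDerivAt.comp p ((hz₁.mul hζ).add (h₂.fst.mul (hζ.pow 2)))
  have h := (hw.sub (hP.const_mul 2)).fderiv
  refine (DFunLike.congr_fun h v).trans ?_
  simp
  ring

/-- The weight `+1` graded vector fields
`(2i β̄₁ z₁ ζ + β₁ w, 2i β̄₁ z₂ ζ − i β₁ z₁ + i β₂ ζ², i β̄₁ ζ², 2i β̄₁ ζ w)`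
are tangent to the weighted model hypersurface
`Q = {Im w = 2 Re (z₁ ζ̄ + z₂ ζ̄²)}` at every point of `Q`. -/
theorem g_plus_one_tangent_to_cubic_model
    (Q : Set (ℂ × ℂ × ℂ × ℂ))
    (hQ : Q = {p : ℂ × ℂ × ℂ × ℂ | p.2.2.2.im =
      2 * (p.1 * (starRingEnd ℂ) p.2.2.1 + p.2.1 * ((starRingEnd ℂ) p.2.2.1) ^ 2).re})
    (ρ : ℂ × ℂ × ℂ × ℂ → ℝ)
    (hρ : ∀ p, ρ p = p.2.2.2.im -
      2 * (p.1 * (starRingEnd ℂ) p.2.2.1 + p.2.1 * ((starRingEnd ℂ) p.2.2.1) ^ 2).re)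
    (β₁ : ℂ) (β₂ : ℝ)
    (X : ℂ × ℂ × ℂ × ℂ → ℂ × ℂ × ℂ × ℂ)
    (hX : ∀ p, X p = (2 * I * (starRingEnd ℂ) β₁ * p.1 * p.2.2.1 + β₁ * p.2.2.2,
      2 * I * (starRingEnd ℂ) β₁ * p.2.1 * p.2.2.1 - I * β₁ * p.1 + I * (β₂ : ℂ) * p.2.2.1 ^ 2,
      I * (starRingEnd ℂ) β₁ * p.2.2.1 ^ 2,
      2 * I * (starRingEnd ℂ) β₁ * p.2.2.1 * p.2.2.2)) :
    ∀ p ∈ Q, fderiv ℝ ρ p (X p) = 0 := by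
  intro p hp
  have hw : p.2.2.2.im = 2 * (p.1 * (starRingEnd ℂ) p.2.2.1 +
      p.2.1 * ((starRingEnd ℂ) p.2.2.1) ^ 2).re := by rwa [hQ] at hp
  rw [funext hρ, fderiv_cubic_model_apply, hX]
  simp [pow_two] at hw ⊢
  linear_combination (-4 * (β₁.re * p.2.2.1.im - β₁.im * p.2.2.1.re)) * hw
end

section
/- Let Q ⊂ ℂ⁴ be the real hypersurface Q = {(z₁,z₂,ζ,w) ∈ ℂ⁴ : Im w = 2 Re(z₁·conj ζ + z₂·(conj ζ)²)}. Then for every real t the polynomial map (z₁,z₂,ζ,w) ↦ (z₁ + i t ζ, z₂, ζ, w) maps Q bijectively onto itself. -/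
open Complex

/-- The term `i t ζ ζ̄` is purely imaginary, so the shear `z ↦ z + i t ζ` leaves `Re (z ζ̄ + c)`
unchanged. -/
theorem re_add_I_mul_mul_conj (t : ℝ) (z ζ c : ℂ) :
    ((z + I * (t : ℂ) * ζ) * (starRingEnd ℂ) ζ + c).re = (z * (starRingEnd ℂ) ζ + c).re := by
  simp only [add_re, mul_re, add_im, mul_im, I_re, I_im, ofReal_re, ofReal_im, conj_re, conj_im]
  ring

/-- For every real `t`, the polynomial map `(z₁,z₂,ζ,w) ↦ (z₁ + i t ζ, z₂, ζ, w)`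
maps the weighted model hypersurface `Im w = 2 Re (z₁ ζ̄ + z₂ ζ̄²)` in `ℂ⁴`
bijectively onto itself. -/
theorem st_minus_flow_bijOn_cubic_model
    (Q : Set (ℂ × ℂ × ℂ × ℂ))
    (hQ : Q = {p : ℂ × ℂ × ℂ × ℂ | p.2.2.2.im =
      2 * (p.1 * (starRingEnd ℂ) p.2.2.1 + p.2.1 * ((starRingEnd ℂ) p.2.2.1) ^ 2).re})
    (t : ℝ) :
    Set.BijOn (fun p : ℂ × ℂ × ℂ × ℂ =>
      (p.1 + I * (t : ℂ) * p.2.2.1, p.2.1, p.2.2.1, p.2.2.2)) Q Q := by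
  subst hQ
  refine ⟨?_, ?_, ?_⟩
  · rintro ⟨z₁, z₂, ζ, w⟩ h
    exact h.trans (congrArg (2 * ·) (re_add_I_mul_mul_conj t z₁ ζ _).symm)
  · rintro ⟨z₁, z₂, ζ, w⟩ - ⟨z₁', z₂', ζ', w'⟩ - h
    simp only [Prod.mk.injEq] at h ⊢
    obtain ⟨h₁, h₂, rfl, h₄⟩ := h
    exact ⟨add_right_cancel h₁, h₂, rfl, h₄⟩
  · rintro ⟨z₁, z₂, ζ, w⟩ h
    refine ⟨(z₁ + I * ((-t : ℝ) : ℂ) * ζ, z₂, ζ, w), ?_, ?_⟩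
    · exact h.trans (congrArg (2 * ·) (re_add_I_mul_mul_conj (-t) z₁ ζ _).symm)
    · simp
end

section
/- Let Q ⊂ ℂ⁴ be the real hypersurface Q = {(z₁,z₂,ζ,w) ∈ ℂ⁴ : Im w = 2 Re(z₁·conj ζ + z₂·(conj ζ)²)}. Fix β ∈ ℂ and t ∈ ℝ, and for ζ ∈ ℂ set D(ζ) = 1 − i·(conj β)·ζ·t. Then for every point (z₁,z₂,ζ,w) ∈ Q with D(ζ) ≠ 0, the point ( (z₁ + β w t)/D(ζ)², (z₂ − i β z₁ t − (i/2) β² w t²)/D(ζ)², ζ/D(ζ), w/D(ζ)² ) again belongs to Q. -/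
open Complex

/-- `im w = 2 re u` says that `u + (I / 2) w` is purely imaginary. -/
lemma im_eq_two_mul_re_iff (u w : ℂ) : w.im = 2 * u.re ↔ (u + I / 2 * w).re = 0 := by
  have h : (u + I / 2 * w).re = u.re - w.im / 2 := by
    simp [div_mul_eq_mul_div]
    ring
  rw [h]
  constructor <;> intro _ <;> linarith

/-- The defining expression of the model is scaled by `1 / (d * conj d) ^ 2`, where `c` plays the
role of the conjugate of `ζ` and `e = 1 + I b c` that of the conjugate of `d`. -/
lemma model_expression_transform (z₁ z₂ w b c d e : ℂ) (hd : d ≠ 0) (he : e ≠ 0)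
    (hec : e = 1 + I * b * c) :
    (z₁ + b * w) / d ^ 2 * (c / e) +
        (z₂ - I * b * z₁ - I / 2 * b ^ 2 * w) / d ^ 2 * (c / e) ^ 2 + I / 2 * (w / d ^ 2) =
      (z₁ * c + z₂ * c ^ 2 + I / 2 * w) / (d * e) ^ 2 := by
  field_simp
  subst hec
  linear_combination (2 * b * c * w + I * b ^ 2 * c ^ 2 * w) * I_sq

/-- The rational transformation (time-`t` flow of a positive-weight
infinitesimal automorphism) preserves the weighted model hypersurface
`Q = {Im w = 2 Re (z₁ ζ̄ + z₂ ζ̄²)}`: for every point of `Q` at which the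
denominator `D(ζ) = 1 − i β̄ ζ t` does not vanish, the image point again
lies on `Q`. -/
theorem rational_flow_preserves_cubic_model
    (Q : Set (ℂ × ℂ × ℂ × ℂ))
    (hQ : Q = {p : ℂ × ℂ × ℂ × ℂ | p.2.2.2.im =
      2 * (p.1 * (starRingEnd ℂ) p.2.2.1 + p.2.1 * ((starRingEnd ℂ) p.2.2.1) ^ 2).re})
    (β : ℂ) (t : ℝ)
    (D : ℂ → ℂ) (hD : ∀ ζ, D ζ = 1 - I * (starRingEnd ℂ) β * ζ * (t : ℂ)) :
    ∀ p ∈ Q, D p.2.2.1 ≠ 0 →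
      (((p.1 + β * p.2.2.2 * (t : ℂ)) / (D p.2.2.1) ^ 2,
        (p.2.1 - I * β * p.1 * (t : ℂ) - (I / 2) * β ^ 2 * p.2.2.2 * (t : ℂ) ^ 2)
          / (D p.2.2.1) ^ 2,
        p.2.2.1 / D p.2.2.1,
        p.2.2.2 / (D p.2.2.1) ^ 2) : ℂ × ℂ × ℂ × ℂ) ∈ Q := by
  subst hQ
  rintro ⟨z₁, z₂, ζ, w⟩ hp hd
  simp only [Set.mem_ofPred_eq] at hp hd ⊢
  rw [im_eq_two_mul_re_iff] at hp ⊢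
  have hconj : (starRingEnd ℂ) (D ζ) = 1 + I * (β * t) * (starRingEnd ℂ) ζ := by
    simp only [hD, map_sub, map_mul, map_one, conj_I, conj_conj, conj_ofReal]
    ring
  have key := model_expression_transform z₁ z₂ w (β * t) ((starRingEnd ℂ) ζ) (D ζ) _ hd
    ((map_ne_zero _).mpr hd) hconj
  rw [mul_conj, ← ofReal_pow] at key
  have hre := congrArg re key
  rw [div_ofReal_re, hp, zero_div] at hre
  rw [← hre, map_div₀]
  ring_nf
end

section
/- Let Q ⊂ ℂ⁴ be the real hypersurface Q = {(z₁,z₂,ζ,w) ∈ ℂ⁴ : Im w = 2 Re(z₁·conj ζ + z₂·(conj ζ)²)}. Then Q is holomorphically homogeneous by polynomial automorphisms: for every point ξ ∈ Q there exists a map F : ℂ⁴ → ℂ⁴ whose four coordinate functions are (holomorphic) polynomials in (z₁,z₂,ζ,w), which admits an inverse map whose coordinates are also polynomials, such that F(0) = ξ and F maps Q bijectively onto Q. -/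
open Complex

/-- The coordinates of a point of `ℂ⁴` as a `Fin 4`-indexed family. -/
def toVars (p : ℂ × ℂ × ℂ × ℂ) : Fin 4 → ℂ := ![p.1, p.2.1, p.2.2.1, p.2.2.2]

/-- A self-map of `ℂ⁴` is polynomial if each of its four coordinate functions
is given by (the evaluation of) a polynomial in the four complex coordinates. -/
def IsPolyMap (F : ℂ × ℂ × ℂ × ℂ → ℂ × ℂ × ℂ × ℂ) : Prop :=
  ∃ P : Fin 4 → MvPolynomial (Fin 4) ℂ,
    ∀ p, toVars (F p) = fun i => MvPolynomial.eval (toVars p) (P i)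

/-- The quadratic polynomial in `(z₁, z₂, ζ)` by which the shift moving the origin to `(a, b, c, d)`
changes the last coordinate, up to the factor `2 i` and the constant `d`. -/
noncomputable def shiftCorrection (a b c z₁ z₂ ζ : ℂ) : ℂ :=
  (starRingEnd ℂ) c * z₁ - (starRingEnd ℂ) c ^ 2 * z₂
    + ((starRingEnd ℂ) a + 2 * (starRingEnd ℂ) b * c) * ζ + (starRingEnd ℂ) b * ζ ^ 2

/-- The triangular polynomial map moving the origin to `(a, b, c, d)`. -/
noncomputable def shift (a b c d : ℂ) (p : ℂ × ℂ × ℂ × ℂ) : ℂ × ℂ × ℂ × ℂ :=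
  (p.1 + a - 2 * (starRingEnd ℂ) c * p.2.1, p.2.1 + b, p.2.2.1 + c,
    p.2.2.2 + d + 2 * I * shiftCorrection a b c p.1 p.2.1 p.2.2.1)

/-- The inverse of `shift a b c d`. -/
noncomputable def shiftInv (a b c d : ℂ) (p : ℂ × ℂ × ℂ × ℂ) : ℂ × ℂ × ℂ × ℂ :=
  (p.1 - a + 2 * (starRingEnd ℂ) c * (p.2.1 - b), p.2.1 - b, p.2.2.1 - c,
    p.2.2.2 - d - 2 * I * shiftCorrection a b c
      (p.1 - a + 2 * (starRingEnd ℂ) c * (p.2.1 - b)) (p.2.1 - b) (p.2.2.1 - c))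

theorem leftInverse_shiftInv_shift (a b c d : ℂ) :
    Function.LeftInverse (shiftInv a b c d) (shift a b c d) := by
  rintro ⟨z₁, z₂, ζ, w⟩
  simp only [shift, shiftInv, shiftCorrection, Prod.mk.injEq]
  refine ⟨?_, ?_, ?_, ?_⟩ <;> ring

theorem rightInverse_shiftInv_shift (a b c d : ℂ) :
    Function.RightInverse (shiftInv a b c d) (shift a b c d) := by
  rintro ⟨z₁, z₂, ζ, w⟩
  simp only [shift, shiftInv, shiftCorrection, Prod.mk.injEq]
  refine ⟨?_, ?_, ?_, ?_⟩ <;> ring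

theorem shift_zero (a b c d : ℂ) : shift a b c d (0, 0, 0, 0) = (a, b, c, d) := by
  simp [shift, shiftCorrection]

theorem isPolyMap_shift (a b c d : ℂ) : IsPolyMap (shift a b c d) := by
  let γ := (starRingEnd ℂ) c
  let C : ℂ →+* MvPolynomial (Fin 4) ℂ := MvPolynomial.C
  let X : Fin 4 → MvPolynomial (Fin 4) ℂ := MvPolynomial.X
  refine ⟨![X 0 + C a - C (2 * γ) * X 1, X 1 + C b, X 2 + C c,
    X 3 + C d + C (2 * I) * (C γ * X 0 - C (γ ^ 2) * X 1
      + C ((starRingEnd ℂ) a + 2 * (starRingEnd ℂ) b * c) * X 2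
      + C ((starRingEnd ℂ) b) * X 2 ^ 2)], fun p => ?_⟩
  funext i
  fin_cases i <;> simp [toVars, shift, shiftCorrection, C, X, γ]

theorem isPolyMap_shiftInv (a b c d : ℂ) : IsPolyMap (shiftInv a b c d) := by
  let γ := (starRingEnd ℂ) c
  let C : ℂ →+* MvPolynomial (Fin 4) ℂ := MvPolynomial.C
  let X : Fin 4 → MvPolynomial (Fin 4) ℂ := MvPolynomial.X
  refine ⟨![X 0 - C a + C (2 * γ) * (X 1 - C b), X 1 - C b, X 2 - C c,
    X 3 - C d - C (2 * I) * (C γ * (X 0 - C a + C (2 * γ) * (X 1 - C b))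
      - C (γ ^ 2) * (X 1 - C b)
      + C ((starRingEnd ℂ) a + 2 * (starRingEnd ℂ) b * c) * (X 2 - C c)
      + C ((starRingEnd ℂ) b) * (X 2 - C c) ^ 2)], fun p => ?_⟩
  funext i
  fin_cases i <;> simp [toVars, shiftInv, shiftCorrection, C, X, γ]

/-- Shifting by a point `(a, b, c, d)` of the model hypersurface preserves its defining function. -/
theorem shift_definingFunction {a b c d : ℂ}
    (h : d.im = 2 * (a * (starRingEnd ℂ) c + b * (starRingEnd ℂ) c ^ 2).re)
    (p : ℂ × ℂ × ℂ × ℂ) :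
    (shift a b c d p).2.2.2.im - 2 * ((shift a b c d p).1 * (starRingEnd ℂ) (shift a b c d p).2.2.1
        + (shift a b c d p).2.1 * (starRingEnd ℂ) (shift a b c d p).2.2.1 ^ 2).re
      = p.2.2.2.im - 2 * (p.1 * (starRingEnd ℂ) p.2.2.1
        + p.2.1 * (starRingEnd ℂ) p.2.2.1 ^ 2).re := by
  simp only [shift, shiftCorrection, pow_two, add_re, add_im, sub_re, sub_im, mul_re, mul_im,
    conj_re, conj_im, I_re, I_im, re_ofNat, im_ofNat] at h ⊢
  linear_combination h

/-- The weighted model hypersurface `Q = {Im w = 2 Re (z₁ ζ̄ + z₂ ζ̄²)} ⊂ ℂ⁴`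
is holomorphically homogeneous by polynomial automorphisms: every point
`ξ ∈ Q` is the image of the origin under a polynomial automorphism of `ℂ⁴`
(with polynomial inverse) mapping `Q` bijectively onto itself. -/
theorem cubic_model_polynomially_homogeneous
    (Q : Set (ℂ × ℂ × ℂ × ℂ))
    (hQ : Q = {p : ℂ × ℂ × ℂ × ℂ | p.2.2.2.im =
      2 * (p.1 * (starRingEnd ℂ) p.2.2.1 + p.2.1 * ((starRingEnd ℂ) p.2.2.1) ^ 2).re}) :
    ∀ ξ ∈ Q, ∃ F G : ℂ × ℂ × ℂ × ℂ → ℂ × ℂ × ℂ × ℂ,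
      IsPolyMap F ∧ IsPolyMap G ∧
      Function.LeftInverse G F ∧ Function.RightInverse G F ∧
      F (0, 0, 0, 0) = ξ ∧ Set.BijOn F Q Q := by
  subst hQ
  rintro ⟨a, b, c, d⟩ hξ
  have hQ_iff (p : ℂ × ℂ × ℂ × ℂ) := sub_eq_zero.symm.trans
    ((Eq.congr_left (shift_definingFunction hξ p)).trans sub_eq_zero)
  refine ⟨shift a b c d, shiftInv a b c d, isPolyMap_shift a b c d, isPolyMap_shiftInv a b c d,
    leftInverse_shiftInv_shift a b c d, rightInverse_shiftInv_shift a b c d,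
    shift_zero a b c d, fun p hp => (hQ_iff p).2 hp,
    (leftInverse_shiftInv_shift a b c d).injective.injOn, fun q hq => ?_⟩
  have hq' := rightInverse_shiftInv_shift a b c d q
  exact ⟨shiftInv a b c d q, (hQ_iff _).1 (hq'.symm ▸ hq), hq'⟩
end

section
/- Let n ≥ 3, let α, β ∈ ℕⁿ be multi-indices, and let Γ ⊂ ℂ^{n+1} be the real hypersurface Γ = {(z,w) ∈ ℂⁿ × ℂ : Im w = 2 Re(z^α · conj(z)^β)}, where z^α = Π_j z_j^{α_j}. Let ρ(z,w) = Im w − 2 Re(z^α · conj(z)^β). Then Γ is holomorphically degenerate: there exists c = (c₁,…,cₙ) ∈ ℂⁿ with c ≠ 0 such that the linear holomorphic vector field with coefficient vector X(z,w) = (c₁ z₁, …, cₙ zₙ, 0) satisfies: for every point p ∈ ℂ^{n+1} the real Fréchet derivative of ρ at p evaluated at X(p) equals zero; in particular this nonzero holomorphic vector field is tangent to Γ at every point of Γ. -/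
open Complex

/-- Two linear equations in at least three unknowns have a common nonzero solution. -/
lemma exists_ne_zero_sum_mul_eq_zero {K : Type*} [Field K] {n : ℕ} (hn : 3 ≤ n)
    (a b : Fin n → K) :
    ∃ c : Fin n → K, c ≠ 0 ∧ ∑ j, c j * a j = 0 ∧ ∑ j, c j * b j = 0 := by
  let L : (Fin n → K) →ₗ[K] K × K :=
    (Fintype.linearCombination K a).prod (Fintype.linearCombination K b)
  have hL : LinearMap.ker L ≠ ⊥ := by
    apply LinearMap.ker_ne_bot_of_finrank_lt
    simp only [Module.finrank_prod, Module.finrank_self, Module.finrank_fin_fun]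
    omega
  obtain ⟨c, hc, hc0⟩ := (Submodule.ne_bot_iff _).mp hL
  have h : L c = 0 := hc
  have h1 := congrArg Prod.fst h
  have h2 := congrArg Prod.snd h
  exact ⟨c, hc0, by simpa [L, Fintype.linearCombination_apply] using h1,
    by simpa [L, Fintype.linearCombination_apply] using h2⟩

/-- A monomial is invariant under the diagonal flow `z_j ↦ exp (t_j) z_j` if its weighted
degree vanishes. -/
lemma prod_exp_mul_pow_eq {ι : Type*} [Fintype ι] (a : ι → ℕ) (t z : ι → ℂ)
    (h : ∑ j, t j * (a j : ℂ) = 0) :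
    ∏ j, (exp (t j) * z j) ^ a j = ∏ j, z j ^ a j := by
  simp_rw [mul_pow, Finset.prod_mul_distrib, ← Complex.exp_nat_mul]
  rw [← Complex.exp_sum]
  simp_rw [mul_comm _ (t _), h, Complex.exp_zero, one_mul]

/-- The derivative of a function constant along the curve `t ↦ (exp (t c_j) z_j, w)`
annihilates its initial velocity. -/
lemma fderiv_diagonal_eq_zero {ι : Type*} [Fintype ι] {f : (ι → ℂ) × ℂ → ℝ}
    {p : (ι → ℂ) × ℂ} (hf : DifferentiableAt ℝ f p) (c : ι → ℂ)
    (hc : ∀ t : ℝ, f (fun j => exp (t * c j) * p.1 j, p.2) = f p) :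
    fderiv ℝ f p (fun j => c j * p.1 j, 0) = 0 := by
  have hγ : HasDerivAt (fun t : ℝ => ((fun j => exp (t * c j) * p.1 j, p.2) : (ι → ℂ) × ℂ))
      (fun j => c j * p.1 j, 0) 0 := by
    refine HasDerivAt.prodMk (hasDerivAt_pi.mpr fun j => ?_) (hasDerivAt_const _ _)
    have h := ((((hasDerivAt_id (0 : ℝ)).ofReal_comp).mul_const (c j)).cexp).mul_const (p.1 j)
    simpa using h
  have hp : ((fun j => exp (((0 : ℝ) : ℂ) * c j) * p.1 j, p.2) : (ι → ℂ) × ℂ) = p := by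
    simp
  have hcomp := HasFDerivAt.comp_hasDerivAt (0 : ℝ) (l := f) (l' := fderiv ℝ f p)
    (by rw [hp]; exact hf.hasFDerivAt) hγ
  have hconst : HasDerivAt (fun _ : ℝ => f p) 0 0 := hasDerivAt_const _ _
  exact hcomp.unique (by simpa only [Function.comp_def, hc] using hconst)

/-- For `n ≥ 3`, every monomial model hypersurface
`Γ = {Im w = 2 Re (z^α z̄^β)} ⊂ ℂ^{n+1}` is holomorphically degenerate:
there is a nonzero linear holomorphic vector field `(c₁ z₁, …, cₙ zₙ, 0)`
that annihilates the real Fréchet derivative of the defining function `ρ`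
at every point; in particular it is tangent to `Γ` at every point of `Γ`. -/
theorem monomial_hypersurface_holomorphically_degenerate
    (n : ℕ) (hn : 3 ≤ n) (α β : Fin n → ℕ)
    (Γ : Set ((Fin n → ℂ) × ℂ))
    (hΓ : Γ = {p | p.2.im =
      2 * ((∏ j : Fin n, p.1 j ^ α j) *
        (∏ j : Fin n, ((starRingEnd ℂ) (p.1 j)) ^ β j)).re})
    (ρ : (Fin n → ℂ) × ℂ → ℝ)
    (hρ : ∀ p, ρ p = p.2.im -
      2 * ((∏ j : Fin n, p.1 j ^ α j) *
        (∏ j : Fin n, ((starRingEnd ℂ) (p.1 j)) ^ β j)).re) :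
    ∃ c : Fin n → ℂ, c ≠ 0 ∧
      ∀ p : (Fin n → ℂ) × ℂ,
        fderiv ℝ ρ p ((fun j => c j * p.1 j), 0) = 0 := by
  obtain ⟨c, hc0, hα, hβ⟩ :=
    exists_ne_zero_sum_mul_eq_zero hn (fun j => (α j : ℂ)) (fun j => (β j : ℂ))
  refine ⟨c, hc0, fun p => fderiv_diagonal_eq_zero ?_ c fun t => ?_⟩
  · have hconj : ∀ j, Differentiable ℝ
        fun p : (Fin n → ℂ) × ℂ => (starRingEnd ℂ) (p.1 j) := fun j =>
      conjCLE.differentiable.comp (by fun_prop)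
    have him : Differentiable ℝ fun p : (Fin n → ℂ) × ℂ => p.2.im :=
      imCLM.differentiable.comp differentiable_snd
    have hprod : Differentiable ℝ fun p : (Fin n → ℂ) × ℂ =>
        (∏ j : Fin n, p.1 j ^ α j) * ∏ j : Fin n, ((starRingEnd ℂ) (p.1 j)) ^ β j := by
      fun_prop
    have hre := reCLM.differentiable.comp hprod
    rw [funext hρ]
    exact (him.sub (hre.const_mul 2)) p
  · have h : ∀ a : Fin n → ℕ, ∑ j, c j * (a j : ℂ) = 0 →
        ∏ j, (exp (t * c j) * p.1 j) ^ a j = ∏ j, p.1 j ^ a j := fun a ha =>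
      prod_exp_mul_pow_eq a _ _ (by simp_rw [mul_assoc, ← Finset.mul_sum, ha, mul_zero])
    simp_rw [hρ, ← map_pow, ← map_prod, h α hα, h β hβ]
end

section
/- Let n ≥ 4, let ε_j ∈ {+1, −1} for j = 4,…,n, and let M ⊂ ℂ^{n+1} be the real hypersurface M = {(z₁,…,zₙ,w) : Im w = 2 Re(z₁·conj z₂ + z₁²·conj z₃) + Σ_{j=4}^n ε_j |z_j|²}. Then for all a, b ∈ ℂ and all c₄,…,cₙ ∈ ℂ the polynomial map z₁ ↦ z₁, z₂ ↦ z₂ + a, z₃ ↦ z₃ + b, z_j ↦ z_j + c_j (j = 4,…,n), w ↦ w + 2i·((conj a)·z₁ + (conj b)·z₁² + Σ_{j=4}^n ε_j (conj c_j)·z_j) + i·Σ_{j=4}^n ε_j |c_j|² maps M bijectively onto itself. -/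
open Complex

/-- A translation of the base coordinate combined with a base-dependent translation of the fibre
coordinate is a bijection. -/
theorem bijective_add_prod_add {A B : Type*} [AddGroup A] [AddGroup B] (v : A) (g : A → B) :
    Function.Bijective (fun p : A × B => (p.1 + v, p.2 + g p.1)) := by
  refine ⟨?_, fun q => ⟨(q.1 - v, q.2 - g (q.1 - v)), by simp⟩⟩
  rintro ⟨x, y⟩ ⟨x', y'⟩ h
  simp only [Prod.mk.injEq, add_left_inj] at h
  obtain ⟨rfl, h⟩ := h
  simpa using h

theorem sum_mul_normSq_add {ι : Type*} (s : Finset ι) (ε : ι → ℝ) (z c : ι → ℂ) :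
    ∑ j ∈ s, ε j * normSq (z j + c j) =
      ∑ j ∈ s, ε j * normSq (z j)
        + 2 * (∑ j ∈ s, (ε j : ℂ) * (starRingEnd ℂ) (c j) * z j).re
        + ∑ j ∈ s, ε j * normSq (c j) := by
  rw [re_sum, Finset.mul_sum, ← Finset.sum_add_distrib, ← Finset.sum_add_distrib]
  refine Finset.sum_congr rfl fun j _ => ?_
  simp [normSq_apply]
  ring

/-- The translations `z₁ ↦ z₁, z₂ ↦ z₂ + a, z₃ ↦ z₃ + b, z_j ↦ z_j + c_j
(j ≥ 4), w ↦ w + 2i(ā z₁ + b̄ z₁² + Σ_{j≥4} ε_j c̄_j z_j) + i Σ_{j≥4} ε_j |c_j|²`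
map the hypersurface `Im w = 2 Re (z₁ z̄₂ + z₁² z̄₃) + Σ_{j≥4} ε_j |z_j|²`
bijectively onto itself. (Fin `n` index `j` corresponds to `z_{j+1}`.) -/
theorem translations_bijOn_zaitsev_hypersurface
    (n : ℕ) (hn : 4 ≤ n) (ε : Fin n → ℝ)
    (hε : ∀ j : Fin n, 3 ≤ (j : ℕ) → ε j = 1 ∨ ε j = -1)
    (M : Set ((Fin n → ℂ) × ℂ))
    (hM : M = {p | p.2.im =
      2 * (p.1 ⟨0, by omega⟩ * (starRingEnd ℂ) (p.1 ⟨1, by omega⟩)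
        + (p.1 ⟨0, by omega⟩) ^ 2 * (starRingEnd ℂ) (p.1 ⟨2, by omega⟩)).re
      + ∑ j ∈ Finset.univ.filter (fun j : Fin n => 3 ≤ (j : ℕ)),
          ε j * Complex.normSq (p.1 j)})
    (a b : ℂ) (c : Fin n → ℂ) :
    Set.BijOn (fun p : (Fin n → ℂ) × ℂ =>
      ((fun j : Fin n =>
        if (j : ℕ) = 0 then p.1 j
        else if (j : ℕ) = 1 then p.1 j + a
        else if (j : ℕ) = 2 then p.1 j + b
        else p.1 j + c j),
        p.2 + 2 * I * ((starRingEnd ℂ) a * p.1 ⟨0, by omega⟩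
          + (starRingEnd ℂ) b * (p.1 ⟨0, by omega⟩) ^ 2
          + ∑ j ∈ Finset.univ.filter (fun j : Fin n => 3 ≤ (j : ℕ)),
              (ε j : ℂ) * (starRingEnd ℂ) (c j) * p.1 j)
        + I * ∑ j ∈ Finset.univ.filter (fun j : Fin n => 3 ≤ (j : ℕ)),
            (ε j : ℂ) * (Complex.normSq (c j) : ℂ))) M M := by
  set f : (Fin n → ℂ) × ℂ → (Fin n → ℂ) × ℂ := _ with hf
  change Set.BijOn f M M
  have bij : Function.Bijective f := by
    convert bijective_add_prod_add
      (fun j : Fin n => if (j : ℕ) = 0 then 0 else if (j : ℕ) = 1 then a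
        else if (j : ℕ) = 2 then b else c j)
      (fun z : Fin n → ℂ => 2 * I * ((starRingEnd ℂ) a * z ⟨0, by omega⟩
          + (starRingEnd ℂ) b * (z ⟨0, by omega⟩) ^ 2
          + ∑ j ∈ Finset.univ.filter (fun j : Fin n => 3 ≤ (j : ℕ)),
              (ε j : ℂ) * (starRingEnd ℂ) (c j) * z j)
        + I * ∑ j ∈ Finset.univ.filter (fun j : Fin n => 3 ≤ (j : ℕ)),
            (ε j : ℂ) * (normSq (c j) : ℂ)) using 1
    funext p
    refine Prod.ext (funext fun j => ?_) (add_assoc _ _ _)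
    simp only [hf, Pi.add_apply]
    split_ifs <;> simp
  have mem_iff (p) : f p ∈ M ↔ p ∈ M := by
    have shift : ∑ j ∈ Finset.univ.filter (fun j : Fin n => 3 ≤ (j : ℕ)),
          ε j * normSq ((f p).1 j) =
        ∑ j ∈ Finset.univ.filter (fun j : Fin n => 3 ≤ (j : ℕ)),
          ε j * normSq (p.1 j + c j) := by
      refine Finset.sum_congr rfl fun j hj => ?_
      have hj : 3 ≤ (j : ℕ) := by simpa using hj
      simp only [hf]
      rw [if_neg (by omega), if_neg (by omega), if_neg (by omega)]
    have cast_sum : ∑ j ∈ Finset.univ.filter (fun j : Fin n => 3 ≤ (j : ℕ)),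
          (ε j : ℂ) * (normSq (c j) : ℂ) =
        ((∑ j ∈ Finset.univ.filter (fun j : Fin n => 3 ≤ (j : ℕ)),
          ε j * normSq (c j) : ℝ) : ℂ) := by
      push_cast
      rfl
    rw [hM, Set.mem_ofPred_eq, Set.mem_ofPred_eq, shift, sum_mul_normSq_add]
    simp only [hf, cast_sum]
    generalize ∑ j ∈ Finset.univ.filter (fun j : Fin n => 3 ≤ (j : ℕ)),
      (ε j : ℂ) * (starRingEnd ℂ) (c j) * p.1 j = S
    generalize ∑ j ∈ Finset.univ.filter (fun j : Fin n => 3 ≤ (j : ℕ)),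
      ε j * normSq (c j) = T
    simp [pow_two]
    constructor <;> intro h <;> linarith
  refine ⟨fun p hp => (mem_iff p).2 hp, bij.injective.injOn, fun q hq => ?_⟩
  obtain ⟨p, rfl⟩ := bij.surjective q
  exact ⟨p, (mem_iff p).1 hq, rfl⟩
end

section
/- Let n ≥ 3, let ε_j ∈ {+1, −1} for j = 3,…,n, and let M ⊂ ℂ^{n+1} be the real hypersurface M = {(z₁,…,zₙ,w) : Im w = 2 Re(z₁·conj z₂) + |z₁|⁴ + Σ_{j=3}^n ε_j |z_j|²}. Then for every a ∈ ℂ and all c₃,…,cₙ ∈ ℂ the polynomial map z₁ ↦ z₁, z₂ ↦ z₂ + a, z_j ↦ z_j + c_j (j = 3,…,n), w ↦ w + 2i·((conj a)·z₁ + Σ_{j=3}^n ε_j (conj c_j)·z_j) + i·Σ_{j=3}^n ε_j |c_j|² maps M bijectively onto itself. -/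
open Complex

/-- The increment of a real-weighted Hermitian form `Σ ε_j |z_j|²` under a translation is the
imaginary part of the correction `2i Σ ε_j c̄_j z_j + i Σ ε_j |c_j|²`. -/
lemma sum_weighted_normSq_add {ι : Type*} (s : Finset ι) (ε : ι → ℝ) (z c : ι → ℂ) :
    ∑ j ∈ s, ε j * normSq (z j + c j) = ∑ j ∈ s, ε j * normSq (z j)
      + (2 * I * ∑ j ∈ s, (ε j : ℂ) * (starRingEnd ℂ) (c j) * z j
        + I * ∑ j ∈ s, (ε j : ℂ) * (normSq (c j) : ℂ)).im := by
  rw [Finset.mul_sum, Finset.mul_sum, ← Finset.sum_add_distrib, im_sum,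
    ← Finset.sum_add_distrib]
  refine Finset.sum_congr rfl fun j _ => ?_
  simp [normSq_apply]
  ring

/-- The translations `z₁ ↦ z₁, z₂ ↦ z₂ + a, z_j ↦ z_j + c_j (j ≥ 3),
w ↦ w + 2i(ā z₁ + Σ_{j≥3} ε_j c̄_j z_j) + i Σ_{j≥3} ε_j |c_j|²` map the
generalized Winkelmann hypersurface
`Im w = 2 Re (z₁ z̄₂) + |z₁|⁴ + Σ_{j≥3} ε_j |z_j|²` bijectively onto itself.
(Fin `n` index `j` corresponds to `z_{j+1}`.) -/
theorem translations_bijOn_winkelmann_hypersurface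
    (n : ℕ) (hn : 3 ≤ n) (ε : Fin n → ℝ)
    (hε : ∀ j : Fin n, 2 ≤ (j : ℕ) → ε j = 1 ∨ ε j = -1)
    (M : Set ((Fin n → ℂ) × ℂ))
    (hM : M = {p | p.2.im =
      2 * (p.1 ⟨0, by omega⟩ * (starRingEnd ℂ) (p.1 ⟨1, by omega⟩)).re
      + (Complex.normSq (p.1 ⟨0, by omega⟩)) ^ 2
      + ∑ j ∈ Finset.univ.filter (fun j : Fin n => 2 ≤ (j : ℕ)),
          ε j * Complex.normSq (p.1 j)})
    (a : ℂ) (c : Fin n → ℂ) :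
    Set.BijOn (fun p : (Fin n → ℂ) × ℂ =>
      ((fun j : Fin n =>
        if (j : ℕ) = 0 then p.1 j
        else if (j : ℕ) = 1 then p.1 j + a
        else p.1 j + c j),
        p.2 + 2 * I * ((starRingEnd ℂ) a * p.1 ⟨0, by omega⟩
          + ∑ j ∈ Finset.univ.filter (fun j : Fin n => 2 ≤ (j : ℕ)),
              (ε j : ℂ) * (starRingEnd ℂ) (c j) * p.1 j)
        + I * ∑ j ∈ Finset.univ.filter (fun j : Fin n => 2 ≤ (j : ℕ)),
            (ε j : ℂ) * (Complex.normSq (c j) : ℂ))) M M := by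
  set F := fun p : (Fin n → ℂ) × ℂ =>
      ((fun j : Fin n =>
        if (j : ℕ) = 0 then p.1 j
        else if (j : ℕ) = 1 then p.1 j + a
        else p.1 j + c j),
        p.2 + 2 * I * ((starRingEnd ℂ) a * p.1 ⟨0, by omega⟩
          + ∑ j ∈ Finset.univ.filter (fun j : Fin n => 2 ≤ (j : ℕ)),
              (ε j : ℂ) * (starRingEnd ℂ) (c j) * p.1 j)
        + I * ∑ j ∈ Finset.univ.filter (fun j : Fin n => 2 ≤ (j : ℕ)),
            (ε j : ℂ) * (Complex.normSq (c j) : ℂ)) with hF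
  have mem_iff : ∀ p, F p ∈ M ↔ p ∈ M := by
    intro p
    have hsum : ∑ j ∈ Finset.univ.filter (fun j : Fin n => 2 ≤ (j : ℕ)),
        ε j * normSq ((F p).1 j) = ∑ j ∈ Finset.univ.filter (fun j : Fin n => 2 ≤ (j : ℕ)),
        ε j * normSq (p.1 j + c j) := by
      refine Finset.sum_congr rfl fun j hj => ?_
      have hj' : 2 ≤ (j : ℕ) := by simpa using hj
      simp [hF, show (j : ℕ) ≠ 0 by omega, show (j : ℕ) ≠ 1 by omega]
    rw [sum_weighted_normSq_add] at hsum
    rw [hM, Set.mem_ofPred_eq, Set.mem_ofPred_eq, hsum]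
    generalize ∑ j ∈ Finset.univ.filter (fun j : Fin n => 2 ≤ (j : ℕ)),
      ε j * normSq (p.1 j) = S
    simp only [hF, one_ne_zero, if_true, if_false]
    generalize ∑ j ∈ Finset.univ.filter (fun j : Fin n => 2 ≤ (j : ℕ)),
      (ε j : ℂ) * (starRingEnd ℂ) (c j) * p.1 j = T
    generalize ∑ j ∈ Finset.univ.filter (fun j : Fin n => 2 ≤ (j : ℕ)),
      (ε j : ℂ) * (normSq (c j) : ℂ) = U
    simp only [add_im, mul_im, mul_re, add_re, I_re, I_im, conj_re, conj_im, re_ofNat, im_ofNat]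
    constructor <;> intro h <;> linarith
  refine ⟨fun p hp => (mem_iff p).2 hp, ?_, fun q hq => ?_⟩
  · rintro ⟨z, w⟩ - ⟨z', w'⟩ - h
    obtain ⟨h1, h2⟩ := Prod.mk.inj h
    obtain rfl : z = z' := by
      funext j
      have hj := congrFun h1 j
      dsimp only at hj
      split_ifs at hj <;> simpa using hj
    simpa using h2
  · let z : Fin n → ℂ := fun j =>
      if (j : ℕ) = 0 then q.1 j else if (j : ℕ) = 1 then q.1 j - a else q.1 j - c j
    have hq' : F (z, q.2 - (F (z, 0)).2) = q := by
      refine Prod.ext (funext fun j => ?_) ?_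
      · simp only [hF, z]
        split_ifs <;> simp
      · simp only [hF]
        ring
    exact ⟨_, (mem_iff _).1 (hq'.symm ▸ hq), hq'⟩
end

section
/- Let m ≥ 1 be a natural number and let M ⊂ ℂ³ be the real hypersurface M = {(z₁,z₂,w) : Im w = 2·Re(z₁)·Re(z₂) + (Re z₁)^m}. Then for all real numbers s, s', r, c the affine map z₁ ↦ z₁ + i s, z₂ ↦ z₂ + r + i s', w ↦ w + 2 i r z₁ + c maps M bijectively onto itself. -/
open Complex

/-- The affine maps `z₁ ↦ z₁ + i s, z₂ ↦ z₂ + r + i s', w ↦ w + 2 i r z₁ + c`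
map the tube hypersurface `Im w = 2 Re(z₁) Re(z₂) + (Re z₁)^m` in `ℂ³`
bijectively onto itself, for all real `s, s', r, c`. -/
theorem affine_maps_bijOn_loboda_tube
    (m : ℕ) (hm : 1 ≤ m)
    (M : Set (ℂ × ℂ × ℂ))
    (hM : M = {p : ℂ × ℂ × ℂ | p.2.2.im = 2 * p.1.re * p.2.1.re + p.1.re ^ m})
    (s s' r c : ℝ) :
    Set.BijOn (fun p : ℂ × ℂ × ℂ =>
      (p.1 + I * (s : ℂ), p.2.1 + (r : ℂ) + I * (s' : ℂ),
        p.2.2 + 2 * I * (r : ℂ) * p.1 + (c : ℂ))) M M := by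
  subst hM
  refine ⟨?_, ?_, ?_⟩
  · rintro ⟨z₁, z₂, w⟩ h
    simp at h ⊢
    linear_combination h
  · rintro ⟨z₁, z₂, w⟩ - ⟨z₁', z₂', w'⟩ - h
    simp only [Prod.mk.injEq, add_left_inj] at h ⊢
    obtain ⟨rfl, rfl, h⟩ := h
    exact ⟨rfl, rfl, add_right_cancel h⟩
  · rintro ⟨z₁, z₂, w⟩ h
    refine ⟨(z₁ - I * s, z₂ - r - I * s', w - 2 * I * r * (z₁ - I * s) - c), ?_, ?_⟩
    · simp at h ⊢
      linear_combination h
    · ext1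
      · ring
      · ext1 <;> ring
end
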